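/- arXiv:1902.09168 — 2 statements merged into one kernel-verified Lean document; each statement's English description precedes it below -/
import Mathlib

section
/- Let f, f' : ℂⁿ → (ℂⁿ)* be invertible symmetric linear maps and let E_•, E'_• be complete flags in ℂⁿ. Then: (1) there exists a unique involution y ∈ S_n (y² = id) such that rank(E_j →f E_i*) = rank y_{[i][j]} for all i, j ∈ [n]; (2) rank(E_j →f E_i*) = rank(E'_j →f' E'_i*) for all i, j ∈ [n] if and only if there exists an invertible linear map g : ℂⁿ → ℂⁿ with f' = (g*)⁻¹ ∘ f ∘ g⁻¹ and E'_i = g(E_i) for all i ∈ [n], where g* denotes the dual (transpose) map of g. -/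
open Classical

namespace UGS

/-- `w ∈ S_n`: a permutation of `ℕ` fixing everything outside `[1, n]`. -/
def IsPermOn (n : ℕ) (w : Equiv.Perm ℕ) : Prop :=
  ∀ i : ℕ, i ∉ Finset.Icc 1 n → w i = i

/-- `rank w_{[i][j]} = #{a ∈ [i] : w(a) ∈ [j]}`. -/
def rankUL (w : Equiv.Perm ℕ) (i j : ℕ) : ℕ :=
  ((Finset.Icc 1 i).filter fun a => w a ∈ Finset.Icc 1 j).card

/-- A complete flag `0 = E_0 ⊆ E_1 ⊆ ⋯ ⊆ E_n = ℂⁿ` with `dim E_i = i`. -/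
def IsCompleteFlag (n : ℕ) (E : ℕ → Submodule ℂ (Fin n → ℂ)) : Prop :=
  (∀ i j, i ≤ j → E i ≤ E j) ∧ (∀ i, i ≤ n → Module.finrank ℂ ↥(E i) = i) ∧
  E n = ⊤

/-- `rank(F →f E*)`: the rank of the composition
`F ↪ ℂⁿ →f (ℂⁿ)* ↠ E*`, where the last map restricts a functional to `E`. -/
noncomputable def rkFE {n : ℕ}
    (f : (Fin n → ℂ) →ₗ[ℂ] Module.Dual ℂ (Fin n → ℂ))
    (F E : Submodule ℂ (Fin n → ℂ)) : ℕ :=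
  Module.finrank ℂ ↥(LinearMap.range (E.subtype.dualMap ∘ₗ (f ∘ₗ F.subtype)))


def Good (n : ℕ) (f : (Fin n → ℂ) →ₗ[ℂ] Module.Dual ℂ (Fin n → ℂ))
    (E : ℕ → Submodule ℂ (Fin n → ℂ)) (S : Finset ℕ) (e : ℕ → Fin n → ℂ)
    (y : Equiv.Perm ℕ) : Prop :=
  (∀ k ∈ Finset.Icc 1 n, e k ∈ E k ∧ e k ∉ E (k - 1)) ∧ Function.Involutive ⇑y ∧
  (∀ k, k ∉ S → y k = k) ∧
  ∀ i ∈ S, ∀ j ∈ Finset.Icc 1 n, f (e i) (e j) = if j = y i then 1 else 0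

def Adapted (n : ℕ) (f : (Fin n → ℂ) →ₗ[ℂ] Module.Dual ℂ (Fin n → ℂ))
    (E : ℕ → Submodule ℂ (Fin n → ℂ)) (e : ℕ → Fin n → ℂ)
    (y : Equiv.Perm ℕ) : Prop :=
  (∀ i, 1 ≤ i → i ≤ n → E i = Submodule.span ℂ (e '' (Finset.Icc 1 i : Set ℕ))) ∧
  (∀ i ∈ Finset.Icc 1 n, ∀ j ∈ Finset.Icc 1 n, f (e i) (e j) = if j = y i then 1 else 0) ∧
  IsPermOn n y ∧ Function.Involutive ⇑y

lemma flag_span {n : ℕ} {E : ℕ → Submodule ℂ (Fin n → ℂ)} (hE : IsCompleteFlag n E)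
    {e : ℕ → Fin n → ℂ} (he : ∀ k ∈ Finset.Icc 1 n, e k ∈ E k ∧ e k ∉ E (k - 1)) :
    ∀ i, i ≤ n → E i = Submodule.span ℂ (e '' (Finset.Icc 1 i : Set ℕ)) := by
  intro i
  induction i with
  | zero =>
    intro _
    have := hE.2.1 0 (Nat.zero_le _)
    rw [Submodule.finrank_eq_zero] at this
    simp [this]
  | succ i ih =>
    intro hi
    have h1 := ih (by omega)
    have h2 := he (i+1) (by simp; omega)
    rw [Nat.add_sub_cancel] at h2
    have h3 : (Finset.Icc 1 (i+1) : Set ℕ) = insert (i+1) (Finset.Icc 1 i : Set ℕ) := by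
      ext x; simp; omega
    rw [h3, Set.image_insert_eq, Submodule.span_insert, ← h1]
    symm
    have hle : Submodule.span ℂ {e (i+1)} ⊔ E i ≤ E (i+1) := by
      refine sup_le ?_ (hE.1 _ _ (by omega))
      rw [Submodule.span_singleton_le_iff_mem]; exact h2.1
    refine Submodule.eq_of_le_of_finrank_le hle ?_
    rw [hE.2.1 _ hi]
    have hlt : E i < Submodule.span ℂ {e (i+1)} ⊔ E i := by
      refine lt_of_le_of_ne le_sup_right ?_
      intro h
      apply h2.2
      rw [h]
      exact Submodule.mem_sup_left (Submodule.mem_span_singleton_self _)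
    have := Submodule.finrank_lt_finrank_of_lt hlt
    rw [hE.2.1 i (by omega)] at this
    omega

lemma sub_good {V : Type*} [AddCommGroup V] [Module ℂ V] {F G : Submodule ℂ V} (h : F ≤ G)
    {x z : V} (hx : x ∈ G ∧ x ∉ F) (hz : z ∈ F) : x - z ∈ G ∧ x - z ∉ F := by
  refine ⟨G.sub_mem hx.1 (h hz), fun h' => hx.2 ?_⟩
  have := F.add_mem h' hz
  simpa using this

lemma smul_good {V : Type*} [AddCommGroup V] [Module ℂ V] {F G : Submodule ℂ V}
    {x : V} (hx : x ∈ G ∧ x ∉ F) {c : ℂ} (hc : c ≠ 0) : c • x ∈ G ∧ c • x ∉ F := by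
  refine ⟨G.smul_mem _ hx.1, fun h' => hx.2 ?_⟩
  rwa [Submodule.smul_mem_iff _ hc] at h'

lemma good_step {n : ℕ} {f : (Fin n → ℂ) →ₗ[ℂ] Module.Dual ℂ (Fin n → ℂ)}
    (hf : Function.Bijective f) (hsym : ∀ v w : Fin n → ℂ, f v w = f w v)
    {E : ℕ → Submodule ℂ (Fin n → ℂ)} (hE : IsCompleteFlag n E) {S : Finset ℕ}
    (hS : S ⊂ Finset.Icc 1 n) {e : ℕ → Fin n → ℂ} {y : Equiv.Perm ℕ}
    (h : Good n f E S e y) :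
    ∃ S' e' y', S ⊂ S' ∧ S' ⊆ Finset.Icc 1 n ∧ Good n f E S' e' y' := by
  obtain ⟨he, hy, hyS, hB⟩ := h
  have hSy : ∀ s ∈ S, y s ∈ S := by
    intro s hs
    by_contra hc
    have h1 := hyS _ hc
    rw [hy s] at h1
    exact hc (h1 ▸ hs)
  -- minimal index not in S
  have hex : ∃ i, i ∈ Finset.Icc 1 n ∧ i ∉ S := by
    obtain ⟨x, hx, hx'⟩ := Finset.exists_of_ssubset hS
    exact ⟨x, hx, hx'⟩
  obtain ⟨i, ⟨hi, hiS⟩, himin⟩ : ∃ i, (i ∈ Finset.Icc 1 n ∧ i ∉ S) ∧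
      ∀ k, k ∈ Finset.Icc 1 n → k ∉ S → i ≤ k :=
    ⟨Nat.find hex, Nat.find_spec hex, fun k hk hk' => Nat.find_min' hex ⟨hk, hk'⟩⟩
  have hex2 : ∃ j, j ∈ Finset.Icc 1 n ∧ f (e i) (e j) ≠ 0 := by
    by_contra hcon
    push Not at hcon
    have h0 : f (e i) = 0 := by
      have htop := flag_span hE he n le_rfl
      rw [hE.2.2] at htop
      apply LinearMap.ext_on (s := e '' (Finset.Icc 1 n : Set ℕ)) htop.symm
      rintro _ ⟨k, hk, rfl⟩
      simpa using hcon k (by simpa using hk)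
    have h1 : e i = 0 := hf.1 (by rw [h0, map_zero])
    exact (he i hi).2 (h1 ▸ Submodule.zero_mem _)
  obtain ⟨j, ⟨hj, hij⟩, hjmin⟩ : ∃ j, (j ∈ Finset.Icc 1 n ∧ f (e i) (e j) ≠ 0) ∧
      ∀ k, k ∈ Finset.Icc 1 n → k < j → f (e i) (e k) = 0 :=
    ⟨Nat.find hex2, Nat.find_spec hex2, fun k hk hk' => by
      have := Nat.find_min hex2 hk'
      by_contra hc
      exact this ⟨hk, hc⟩⟩
  have hSz : ∀ s ∈ S, ∀ k ∈ Finset.Icc 1 n, k ∉ S → f (e s) (e k) = 0 := by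
    intro s hs k hk hkS
    rw [hB s hs k hk, if_neg]
    rintro rfl
    exact hkS (hSy s hs)
  have hjS : j ∉ S := by
    intro hjS
    exact hij (by rw [hsym]; exact hSz j hjS i hi hiS)
  have hile : i ≤ j := himin j hj hjS
  have hmem : ∀ a k, a ∈ Finset.Icc 1 n → a < k → e a ∈ E (k-1) := fun a k ha hk =>
    hE.1 a (k-1) (by omega) (he a ha).1
  rcases hile.eq_or_lt with rfl | hlt
  · -- case i = j
    obtain ⟨c, hc⟩ : ∃ c : ℂ, c * c = (f (e i) (e i))⁻¹ := by
      obtain ⟨c, hc⟩ := IsAlgClosed.exists_pow_nat_eq (f (e i) (e i))⁻¹ (n := 2) (by norm_num)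
      exact ⟨c, by rw [← hc]; ring⟩
    have hc0 : c ≠ 0 := by
      rintro rfl
      rw [mul_zero] at hc
      exact hij (inv_eq_zero.mp hc.symm)
    obtain ⟨u, hu⟩ : ∃ u, u = c • e i := ⟨_, rfl⟩
    have huu : f u u = 1 := by
      simp only [hu, map_smul, LinearMap.smul_apply, smul_eq_mul]
      rw [← mul_assoc, hc, inv_mul_cancel₀ hij]
    have huS : ∀ s ∈ S, f (e s) u = 0 := by
      intro s hs
      simp [hu, hSz s hs i hi hiS]
    refine ⟨insert i S, fun k => if k = i then u else if k ∈ S then e k else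
      e k - f (e k) u • u, y, Finset.ssubset_insert hiS,
      Finset.insert_subset hi hS.1, ?_, hy, ?_, ?_⟩
    · intro k hk
      dsimp only
      split_ifs with h1 h2
      · subst h1; rw [hu]; exact smul_good (he k hk) hc0
      · exact he k hk
      · refine sub_good (hE.1 _ _ (by omega)) (he k hk) ?_
        have : i < k := lt_of_le_of_ne (himin k hk h2) (Ne.symm h1)
        rw [hu]
        exact Submodule.smul_mem _ _ (Submodule.smul_mem _ _ (hmem i k hi this))
    · intro k hk
      exact hyS k (fun h => hk (Finset.mem_insert_of_mem h))
    · intro a ha b hb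
      have hyi : y i = i := hyS i hiS
      rcases Finset.mem_insert.mp ha with rfl | haS
      · rw [hyi]
        by_cases h1 : b = a
        · simp [h1, huu]
        · by_cases h2 : b ∈ S
          · simp only [h1, h2, if_true, if_false]
            rw [hsym]; exact huS b h2
          · simp only [h1, h2, if_true, if_false]
            simp only [map_sub, map_smul, smul_eq_mul, huu, hsym u (e b)]
            ring
      · have hai : a ≠ i := fun h => hiS (h ▸ haS)
        simp only [hai, haS, if_true, if_false]
        by_cases h1 : b = i
        · have : i ≠ y a := fun h => hiS (h ▸ hSy a haS)
          simp [h1, this, huS a haS]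
        · by_cases h2 : b ∈ S
          · simp only [h1, h2, if_true, if_false]
            exact hB a haS b hb
          · have : b ≠ y a := fun h => h2 (h ▸ hSy a haS)
            simp [h1, h2, this, huS a haS, hSz a haS b hb h2]
  · -- case i < j
    have hii : f (e i) (e i) = 0 := hjmin i hi hlt
    obtain ⟨u, hu⟩ : ∃ u, u = e i := ⟨_, rfl⟩
    obtain ⟨c, hc⟩ : ∃ c, c = (f (e i) (e j))⁻¹ := ⟨_, rfl⟩
    have hc0 : c ≠ 0 := by rw [hc]; exact inv_ne_zero hij
    have hcm : c * f (e i) (e j) = 1 := by rw [hc, inv_mul_cancel₀ hij]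
    obtain ⟨v, hv⟩ : ∃ v, v = c • e j - (c * c * f (e j) (e j) / 2) • e i := ⟨_, rfl⟩
    have huu : f u u = 0 := by rw [hu, hii]
    have huv : f u v = 1 := by
      simp [hu, hv, hii, hcm]
    have hvu : f v u = 1 := by rw [hsym, huv]
    have hvv : f v v = 0 := by
      simp only [hv, map_sub, map_smul, LinearMap.sub_apply, LinearMap.smul_apply, smul_eq_mul, hii,
        hsym (e j) (e i)]
      linear_combination (- c * c * f (e j) (e j)) * hcm
    have huS : ∀ s ∈ S, f (e s) u = 0 := by
      intro s hs
      simp [hu, hSz s hs i hi hiS]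
    have hvS : ∀ s ∈ S, f (e s) v = 0 := by
      intro s hs
      simp [hv, hSz s hs i hi hiS, hSz s hs j hj hjS]
    have hij' : i ≠ j := hlt.ne
    have hyi : y i = i := hyS i hiS
    have hyj : y j = j := hyS j hjS
    have hy'S : ∀ s ∈ S, (Equiv.swap i j * y) s = y s := by
      intro s hs
      rw [Equiv.Perm.mul_apply, Equiv.swap_apply_of_ne_of_ne]
      · exact fun h => hiS (h ▸ hSy s hs)
      · exact fun h => hjS (h ▸ hSy s hs)
    have hy'i : (Equiv.swap i j * y) i = j := by simp [hyi]
    have hy'j : (Equiv.swap i j * y) j = i := by simp [hyj]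
    have hy'o : ∀ k, k ∉ S → k ≠ i → k ≠ j → (Equiv.swap i j * y) k = k := by
      intro k h1 h2 h3
      rw [Equiv.Perm.mul_apply, hyS k h1, Equiv.swap_apply_of_ne_of_ne h2 h3]
    generalize Equiv.swap i j * y = y' at *
    refine ⟨insert i (insert j S), fun k => if k = i then u else if k = j then v else
      if k ∈ S then e k else
      e k - (f (e k) v • u + f (e k) u • v), y', ?_, ?_, ?_, ?_, ?_, ?_⟩
    · refine (Finset.ssubset_insert hjS).trans_subset (Finset.subset_insert _ _)
    · exact Finset.insert_subset hi (Finset.insert_subset hj hS.1)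
    · intro k hk
      dsimp only
      split_ifs with h1 h2 h3
      · subst h1; rw [hu]; exact he k hk
      · subst h2
        rw [hv]
        exact sub_good (hE.1 _ _ (by omega)) (smul_good (he k hk) hc0)
          (Submodule.smul_mem _ _ (hmem i k hi hlt))
      · exact he k hk
      · refine sub_good (hE.1 _ _ (by omega)) (he k hk) ?_
        have hik : i < k := lt_of_le_of_ne (himin k hk h3) (Ne.symm h1)
        refine Submodule.add_mem _ (Submodule.smul_mem _ _ (hu ▸ hmem i k hi hik)) ?_
        rcases lt_or_gt_of_ne h2 with hkj | hjk
        · have : f (e k) u = 0 := by rw [hsym, hu]; exact hjmin k hk hkj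
          rw [this, zero_smul]; exact Submodule.zero_mem _
        · rw [hv]
          exact Submodule.smul_mem _ _ (Submodule.sub_mem _
            (Submodule.smul_mem _ _ (hmem j k hj hjk))
            (Submodule.smul_mem _ _ (hmem i k hi hik)))
    · intro k
      by_cases h1 : k = i
      · rw [h1, hy'i, hy'j]
      by_cases h2 : k = j
      · rw [h2, hy'j, hy'i]
      by_cases h3 : k ∈ S
      · rw [hy'S k h3, hy'S _ (hSy k h3), hy k]
      · rw [hy'o k h3 h1 h2, hy'o k h3 h1 h2]
    · intro k hk
      simp only [Finset.mem_insert, not_or] at hk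
      exact hy'o k hk.2.2 hk.1 hk.2.1
    · intro a ha b hb
      rw [Finset.mem_insert, Finset.mem_insert] at ha
      rcases ha with rfl | rfl | haS
      · rw [hy'i]
        by_cases h1 : b = a
        · simp [h1, huu, hij']
        by_cases h2 : b = j
        · simp [h2, huv, hij'.symm]
        by_cases h3 : b ∈ S
        · simp only [h1, h2, h3, if_true, if_false]
          rw [hsym]; exact huS b h3
        · simp only [h1, h2, h3, if_true, if_false]
          simp only [map_sub, map_add, map_smul, smul_eq_mul, huu, huv, hsym u (e b)]
          ring
      · rw [hy'j]
        by_cases h1 : b = i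
        · simp [h1, hvu, hij'.symm]
        by_cases h2 : b = a
        · simp [h2, hvv, hij'.symm]
        by_cases h3 : b ∈ S
        · simp only [h1, h2, h3, hij'.symm, if_true, if_false]
          rw [hsym]; exact hvS b h3
        · simp only [h1, h2, h3, hij'.symm, if_true, if_false]
          simp only [map_sub, map_add, map_smul, smul_eq_mul, hvu, hvv, hsym v (e b)]
          ring
      · have hai : a ≠ i := fun h => hiS (h ▸ haS)
        have haj : a ≠ j := fun h => hjS (h ▸ haS)
        rw [hy'S a haS]
        simp only [hai, haj, haS, if_true, if_false]
        by_cases h1 : b = i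
        · have : i ≠ y a := fun h => hiS (h ▸ hSy a haS)
          simp [h1, this, huS a haS]
        by_cases h2 : b = j
        · have : j ≠ y a := fun h => hjS (h ▸ hSy a haS)
          simp [h2, this, hvS a haS, hij'.symm]
        by_cases h3 : b ∈ S
        · simp only [h1, h2, h3, if_true, if_false]
          exact hB a haS b hb
        · have : b ≠ y a := fun h => h3 (h ▸ hSy a haS)
          simp [h1, h2, h3, this, huS a haS, hvS a haS, hSz a haS b hb h3]

lemma good_full {n : ℕ} {f : (Fin n → ℂ) →ₗ[ℂ] Module.Dual ℂ (Fin n → ℂ)}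
    (hf : Function.Bijective f) (hsym : ∀ v w : Fin n → ℂ, f v w = f w v)
    {E : ℕ → Submodule ℂ (Fin n → ℂ)} (hE : IsCompleteFlag n E) (m : ℕ) :
    ∀ S : Finset ℕ, S ⊆ Finset.Icc 1 n → n ≤ S.card + m → ∀ e y, Good n f E S e y →
    ∃ e y, Good n f E (Finset.Icc 1 n) e y := by
  induction m with
  | zero =>
    intro S hS hc e y h
    have : S = Finset.Icc 1 n := Finset.eq_of_subset_of_card_le hS (by simpa using hc)
    exact ⟨e, y, this ▸ h⟩
  | succ m ih =>
    intro S hS hc e y h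
    rcases eq_or_ne S (Finset.Icc 1 n) with rfl | hne
    · exact ⟨e, y, h⟩
    obtain ⟨S', e', y', h1, h2, h3⟩ := good_step hf hsym hE (Finset.ssubset_iff_subset_ne.mpr ⟨hS, hne⟩) h
    have := Finset.card_lt_card h1
    exact ih S' h2 (by omega) e' y' h3

lemma exists_adapted {n : ℕ} {f : (Fin n → ℂ) →ₗ[ℂ] Module.Dual ℂ (Fin n → ℂ)}
    (hf : Function.Bijective f) (hsym : ∀ v w : Fin n → ℂ, f v w = f w v)
    {E : ℕ → Submodule ℂ (Fin n → ℂ)} (hE : IsCompleteFlag n E) :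
    ∃ e y, Adapted n f E e y := by
  have h0 : ∀ k, ∃ x, k ∈ Finset.Icc 1 n → x ∈ E k ∧ x ∉ E (k-1) := by
    intro k
    by_cases hk : k ∈ Finset.Icc 1 n
    · rw [Finset.mem_Icc] at hk
      have : ¬ E k ≤ E (k-1) := by
        intro hle
        have := Submodule.finrank_mono hle
        rw [hE.2.1 k hk.2, hE.2.1 (k-1) (by omega)] at this
        omega
      obtain ⟨x, hx⟩ := SetLike.not_le_iff_exists.mp this
      exact ⟨x, fun _ => hx⟩
    · exact ⟨0, fun h => absurd h hk⟩
  choose e he using h0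
  obtain ⟨e, y, h1, h2, h3, h4⟩ := good_full hf hsym hE n ∅ (by simp) (by simp) e 1
    ⟨he, fun _ => rfl, fun _ _ => rfl, by simp⟩
  exact ⟨e, y, fun i _ hi => flag_span hE h1 i hi, h4, h3, h2⟩

lemma perm_mem {n : ℕ} {y : Equiv.Perm ℕ} (hy : IsPermOn n y) {i : ℕ}
    (hi : i ∈ Finset.Icc 1 n) : y i ∈ Finset.Icc 1 n := by
  by_contra h
  have := y.injective (hy _ h)
  rw [this] at h
  exact h hi

lemma rank_adapted {n : ℕ} {f : (Fin n → ℂ) →ₗ[ℂ] Module.Dual ℂ (Fin n → ℂ)}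
    {E : ℕ → Submodule ℂ (Fin n → ℂ)} {e : ℕ → Fin n → ℂ} {y : Equiv.Perm ℕ}
    (h : Adapted n f E e y) (i j : ℕ) (hi1 : 1 ≤ i) (hi : i ≤ n) (hj1 : 1 ≤ j) (hj : j ≤ n) :
    rkFE f (E j) (E i) = rankUL y i j := by
  obtain ⟨hE, hB, hp, hy⟩ := h
  let A : Finset ℕ := (Finset.Icc 1 i).filter fun a => y a ∈ Finset.Icc 1 j
  have heE : ∀ a ∈ Finset.Icc 1 i, e a ∈ E i := by
    intro a ha
    rw [hE i hi1 hi]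
    exact Submodule.subset_span ⟨a, by simpa using ha, rfl⟩
  have hsub : ∀ m a, m ≤ n → a ∈ Finset.Icc 1 m → a ∈ Finset.Icc 1 n := by
    intro m a hm ha; rw [Finset.mem_Icc] at *; omega
  let φ : A → Module.Dual ℂ (E i) := fun a => (E i).subtype.dualMap (f (e (y a)))
  have hφ : ∀ (a : A) (b : ℕ) (hb : b ∈ Finset.Icc 1 i), φ a ⟨e b, heE b hb⟩ = if b = a then 1 else 0 := by
    intro a b hb
    have ha := Finset.mem_filter.mp a.2
    have := hB (y a) (hsub j _ hj ha.2) b (hsub i b hi hb)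
    rw [hy] at this
    exact this
  have hli : LinearIndependent ℂ φ := by
    rw [Fintype.linearIndependent_iff]
    intro g hg a
    have ha := Finset.mem_filter.mp a.2
    have := congrArg (fun ψ : Module.Dual ℂ (E i) => ψ ⟨e a, heE a ha.1⟩) hg
    simp only [LinearMap.sum_apply, LinearMap.smul_apply, hφ _ _ ha.1, LinearMap.zero_apply] at this
    simpa [Subtype.coe_inj] using this
  have hrange : LinearMap.range ((E i).subtype.dualMap ∘ₗ (f ∘ₗ (E j).subtype)) =
      Submodule.span ℂ (Set.range φ) := by
    rw [← LinearMap.comp_assoc, LinearMap.range_comp, Submodule.range_subtype, hE j hj1 hj,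
      Submodule.map_span]
    apply le_antisymm
    · rw [Submodule.span_le]
      rintro _ ⟨_, ⟨b, hb, rfl⟩, rfl⟩
      have hb : b ∈ Finset.Icc 1 j := by simpa using hb
      by_cases hyb : y b ∈ Finset.Icc 1 i
      · refine Submodule.subset_span ⟨⟨y b, Finset.mem_filter.mpr ⟨hyb, by rwa [hy]⟩⟩, ?_⟩
        simp [φ, hy b]
      · have : ((E i).subtype.dualMap ∘ₗ f) (e b) = 0 := by
          ext ⟨x, hx⟩
          change f (e b) x = 0
          have hker : E i ≤ LinearMap.ker (f (e b)) := by
            rw [hE i hi1 hi, Submodule.span_le]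
            rintro _ ⟨a, ha, rfl⟩
            have ha : a ∈ Finset.Icc 1 i := by simpa using ha
            change f (e b) (e a) = 0
            rw [hB b (hsub j b hj hb) a (hsub i a hi ha), if_neg]
            rintro rfl
            exact hyb ha
          exact hker hx
        rw [SetLike.mem_coe, this]
        exact Submodule.zero_mem _
    · rw [Submodule.span_le]
      rintro _ ⟨a, rfl⟩
      have ha := Finset.mem_filter.mp a.2
      exact Submodule.subset_span ⟨_, ⟨y a, by simpa using ha.2, rfl⟩, rfl⟩
  unfold rkFE rankUL
  rw [hrange, finrank_span_eq_card hli, Fintype.card_coe]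

lemma rankUL_le {n : ℕ} {y z : Equiv.Perm ℕ}
    (hy : IsPermOn n y)
    (h : ∀ i j, 1 ≤ i → i ≤ n → 1 ≤ j → j ≤ n → rankUL y i j = rankUL z i j)
    (i : ℕ) (hi : i ∈ Finset.Icc 1 n) : z i ≤ y i := by
  have hs : ∀ (w : Equiv.Perm ℕ) j, rankUL w i j =
      rankUL w (i-1) j + if w i ∈ Finset.Icc 1 j then 1 else 0 := by
    intro w j
    rw [Finset.mem_Icc] at hi
    have h3 : Finset.Icc 1 i = insert i (Finset.Icc 1 (i-1)) := by
      ext x; simp; omega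
    unfold rankUL
    rw [h3, Finset.filter_insert]
    split_ifs
    · rw [Finset.card_insert_of_notMem]
      simp; omega
    · simp
  have hyi := perm_mem hy hi
  rw [Finset.mem_Icc] at hyi hi
  have h1 := h i (y i) hi.1 hi.2 hyi.1 hyi.2
  have h2 : rankUL y (i-1) (y i) = rankUL z (i-1) (y i) := by
    rcases Nat.eq_zero_or_pos (i-1) with h0 | h0
    · simp [h0, rankUL]
    · exact h _ _ h0 (by omega) hyi.1 hyi.2
  rw [hs y, hs z, h2, if_pos (by rw [Finset.mem_Icc]; omega)] at h1
  by_contra hc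
  rw [if_neg (by rw [Finset.mem_Icc]; omega)] at h1
  omega

lemma rankUL_inj {n : ℕ} {y z : Equiv.Perm ℕ}
    (hy : IsPermOn n y) (hz : IsPermOn n z)
    (h : ∀ i j, 1 ≤ i → i ≤ n → 1 ≤ j → j ≤ n → rankUL y i j = rankUL z i j) : y = z := by
  ext i
  by_cases hi : i ∈ Finset.Icc 1 n
  · exact le_antisymm
      (rankUL_le hz (fun i j a b c d => (h i j a b c d).symm) i hi) (rankUL_le hy h i hi)
  · rw [hy i hi, hz i hi]

lemma adapted_basis {n : ℕ} {f : (Fin n → ℂ) →ₗ[ℂ] Module.Dual ℂ (Fin n → ℂ)}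
    {E : ℕ → Submodule ℂ (Fin n → ℂ)} {e : ℕ → Fin n → ℂ} {y : Equiv.Perm ℕ}
    (h : Adapted n f E e y) :
    ∃ b : Module.Basis (Fin n) ℂ (Fin n → ℂ), ∀ a : Fin n, b a = e (a + 1) := by
  obtain ⟨hE, hB, hp, hy⟩ := h
  have hmem : ∀ a : Fin n, (a : ℕ) + 1 ∈ Finset.Icc 1 n := by
    intro a; have := a.2; rw [Finset.mem_Icc]; omega
  have hli : LinearIndependent ℂ (fun a : Fin n => e (a + 1)) := by
    rw [Fintype.linearIndependent_iff]
    intro g hg a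
    have := congrArg (f (e (y (a+1)))) hg
    rw [map_sum, map_zero] at this
    rw [← this, Finset.sum_eq_single a]
    · rw [map_smul, hB _ (perm_mem hp (hmem a)) _ (hmem a), hy]; simp
    · intro b _ hb
      rw [map_smul, hB _ (perm_mem hp (hmem a)) _ (hmem b), hy, if_neg]
      · simp
      · intro h; apply hb; ext; omega
    · simp
  refine ⟨basisOfLinearIndependentOfCardEqFinrank' _ hli (by simp), fun a => ?_⟩
  simp

theorem orbit_description_LG (n : ℕ)
    (f f' : (Fin n → ℂ) →ₗ[ℂ] Module.Dual ℂ (Fin n → ℂ))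
    (hf : Function.Bijective f) (hf' : Function.Bijective f')
    (hsym : ∀ v w : Fin n → ℂ, f v w = f w v)
    (hsym' : ∀ v w : Fin n → ℂ, f' v w = f' w v)
    (E E' : ℕ → Submodule ℂ (Fin n → ℂ))
    (hE : IsCompleteFlag n E) (hE' : IsCompleteFlag n E') :
    (∃! y : Equiv.Perm ℕ, IsPermOn n y ∧ Function.Involutive ⇑y ∧
      ∀ i j, 1 ≤ i → i ≤ n → 1 ≤ j → j ≤ n →
        rkFE f (E j) (E i) = rankUL y i j) ∧
    ((∀ i j, 1 ≤ i → i ≤ n → 1 ≤ j → j ≤ n →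
        rkFE f (E j) (E i) = rkFE f' (E' j) (E' i)) ↔
      ∃ g : (Fin n → ℂ) ≃ₗ[ℂ] (Fin n → ℂ),
        (∀ v, f' v = g.dualMap.symm (f (g.symm v))) ∧
        (∀ i, 1 ≤ i → i ≤ n →
          E' i = (E i).map (g : (Fin n → ℂ) →ₗ[ℂ] (Fin n → ℂ)))) := by
  obtain ⟨e, y, h⟩ := exists_adapted hf hsym hE
  refine ⟨⟨y, ⟨h.2.2.1, h.2.2.2, rank_adapted h⟩, ?_⟩, ?_, ?_⟩
  · rintro z ⟨hz, _, hz'⟩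
    refine rankUL_inj hz h.2.2.1 fun i j a b c d => ?_
    rw [← hz' i j a b c d, rank_adapted h i j a b c d]
  · intro hr
    obtain ⟨e', y', h'⟩ := exists_adapted hf' hsym' hE'
    obtain rfl : y = y' := by
      refine rankUL_inj h.2.2.1 h'.2.2.1 fun i j a b c d => ?_
      rw [← rank_adapted h i j a b c d, hr i j a b c d, rank_adapted h' i j a b c d]
    obtain ⟨b, hb⟩ := adapted_basis h
    obtain ⟨b', hb'⟩ := adapted_basis h'
    obtain ⟨g, hg⟩ : ∃ g, g = b.equiv b' (Equiv.refl _) := ⟨_, rfl⟩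
    have hge : ∀ k ∈ Finset.Icc 1 n, g (e k) = e' k := by
      intro k hk
      rw [Finset.mem_Icc] at hk
      obtain ⟨a, rfl⟩ : ∃ a : Fin n, k = a + 1 := ⟨⟨k-1, by omega⟩, by simp; omega⟩
      rw [← hb, ← hb', hg]
      simp
    have hmem : ∀ a : Fin n, (a : ℕ) + 1 ∈ Finset.Icc 1 n := by
      intro a; have := a.2; rw [Finset.mem_Icc]; omega
    have key : f = (f'.compl₁₂ (g : (Fin n → ℂ) →ₗ[ℂ] (Fin n → ℂ)) (g : (Fin n → ℂ) →ₗ[ℂ] (Fin n → ℂ))) := by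
      refine LinearMap.ext_basis b b fun i j => ?_
      rw [LinearMap.compl₁₂_apply, hb, hb]
      simp only [LinearEquiv.coe_coe]
      rw [hge _ (hmem i), hge _ (hmem j), h.2.1 _ (hmem i) _ (hmem j),
        h'.2.1 _ (hmem i) _ (hmem j)]
    refine ⟨g, fun v => ?_, fun i hi1 hi => ?_⟩
    · refine LinearMap.ext fun w => ?_
      change _ = f (g.symm v) (g.symm w)
      rw [key]
      simp
    · rw [h.1 i hi1 hi, h'.1 i hi1 hi, Submodule.map_span, ← Set.image_comp]
      congr 1
      refine Set.image_congr fun k hk => ?_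
      have hk : k ∈ Finset.Icc 1 i := by simpa using hk
      rw [Finset.mem_Icc] at hk
      exact (hge k (by rw [Finset.mem_Icc]; omega)).symm
  · rintro ⟨g, hg, hgE⟩ i j hi1 hi hj1 hj
    have h' : Adapted n f' E' (fun k => g (e k)) y := by
      refine ⟨fun i hi1 hi => ?_, fun i hi j hj => ?_, h.2.2⟩
      · rw [hgE i hi1 hi, h.1 i hi1 hi, Submodule.map_span, ← Set.image_comp]
        rfl
      · rw [hg]
        change f (g.symm (g (e i))) (g.symm (g (e j))) = _
        rw [g.symm_apply_apply, g.symm_apply_apply, h.2.1 i hi j hj]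
    rw [rank_adapted h i j hi1 hi hj1 hj, rank_adapted h' i j hi1 hi hj1 hj]
end UGS
end

section
/- Let f, f' : ℂⁿ → (ℂⁿ)* be invertible skew-symmetric linear maps and let E_•, E'_• be complete flags in ℂⁿ. Then: (1) there exists a unique fixed-point-free involution z ∈ S_n (z² = id and z(i) ≠ i for all i) such that rank(E_j →f E_i*) = rank z_{[i][j]} for all i, j ∈ [n]; (2) rank(E_j →f E_i*) = rank(E'_j →f' E'_i*) for all i, j ∈ [n] if and only if there exists an invertible linear map g : ℂⁿ → ℂⁿ with f' = (g*)⁻¹ ∘ f ∘ g⁻¹ and E'_i = g(E_i) for all i ∈ [n], where g* denotes the dual (transpose) map of g. -/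
open Classical

namespace UGS

structure NF (n : ℕ) (f : (Fin n → ℂ) →ₗ[ℂ] Module.Dual ℂ (Fin n → ℂ))
    (E : ℕ → Submodule ℂ (Fin n → ℂ)) (b : ℕ → (Fin n → ℂ)) (z : Equiv.Perm ℕ)
    (T : Finset ℕ) : Prop where
  sub : T ⊆ Finset.Icc 1 n
  mem : ∀ i ∈ Finset.Icc 1 n, b i ∈ E i
  nmem : ∀ i ∈ Finset.Icc 1 n, b i ∉ E (i - 1)
  inv : Function.Involutive ⇑z
  out : ∀ i, i ∉ T → z i = i
  ne : ∀ i ∈ T, z i ≠ i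
  zero : ∀ i ∈ T, ∀ j ∈ Finset.Icc 1 n, j ≠ z i → f (b i) (b j) = 0
  one : ∀ i ∈ T, i < z i → f (b i) (b (z i)) = 1

theorem NF.zT {n : ℕ} {f : (Fin n → ℂ) →ₗ[ℂ] Module.Dual ℂ (Fin n → ℂ)}
    {E b z T} (h : NF n f E b z T) {i : ℕ} (hi : i ∈ T) : z i ∈ T := by
  by_contra hc
  have := h.out _ hc
  rw [h.inv] at this
  exact h.ne i hi this.symm

theorem flag_zero {n : ℕ} {E : ℕ → Submodule ℂ (Fin n → ℂ)} (hE : IsCompleteFlag n E) :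
    E 0 = ⊥ := Submodule.finrank_eq_zero.1 (hE.2.1 0 (Nat.zero_le _))

theorem flag_span_s19 {n : ℕ} {E : ℕ → Submodule ℂ (Fin n → ℂ)} (hE : IsCompleteFlag n E)
    {b : ℕ → (Fin n → ℂ)} (mem : ∀ i ∈ Finset.Icc 1 n, b i ∈ E i)
    (nmem : ∀ i ∈ Finset.Icc 1 n, b i ∉ E (i - 1)) (m : ℕ) (hm : m ≤ n) :
    E m = Submodule.span ℂ (b '' (Finset.Icc 1 m : Finset ℕ)) := by
  induction m with
  | zero => simp [flag_zero hE]
  | succ m ih =>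
    have ih := ih (by omega)
    have hle : Submodule.span ℂ (b '' (Finset.Icc 1 (m+1) : Finset ℕ)) ≤ E (m+1) := by
      rw [Submodule.span_le]
      rintro _ ⟨i, hi, rfl⟩
      simp only [Finset.coe_Icc, Set.mem_Icc] at hi
      exact hE.1 i (m+1) hi.2 (mem i (Finset.mem_Icc.2 ⟨hi.1, by omega⟩))
    have hlt : E m < Submodule.span ℂ (b '' (Finset.Icc 1 (m+1) : Finset ℕ)) := by
      refine lt_of_le_of_ne ?_ ?_
      · rw [ih]
        apply Submodule.span_mono
        apply Set.image_mono
        intro x hx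
        simp only [Finset.coe_Icc, Set.mem_Icc] at hx ⊢
        omega
      · intro heq
        have h1 : b (m+1) ∈ E m := by
          rw [heq]
          apply Submodule.subset_span
          exact ⟨m+1, by simp, rfl⟩
        exact nmem (m+1) (Finset.mem_Icc.2 ⟨by omega, hm⟩) (by simpa using h1)
    have h2 := Submodule.finrank_lt_finrank_of_lt hlt
    rw [hE.2.1 m (by omega)] at h2
    refine (Submodule.eq_of_le_of_finrank_le hle ?_).symm
    rw [hE.2.1 _ hm]
    omega

theorem exists_ne {n : ℕ} {E : ℕ → Submodule ℂ (Fin n → ℂ)} (hE : IsCompleteFlag n E)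
    {f : (Fin n → ℂ) →ₗ[ℂ] Module.Dual ℂ (Fin n → ℂ)} (hf : Function.Bijective f)
    {b : ℕ → (Fin n → ℂ)} (mem : ∀ i ∈ Finset.Icc 1 n, b i ∈ E i)
    (nmem : ∀ i ∈ Finset.Icc 1 n, b i ∉ E (i - 1)) (i : ℕ) (hi : i ∈ Finset.Icc 1 n) :
    ∃ k, k ∈ Finset.Icc 1 n ∧ f (b i) (b k) ≠ 0 := by
  by_contra! hc
  have h0 : f (b i) = 0 := by
    have htop := flag_span_s19 hE mem nmem n le_rfl
    rw [hE.2.2] at htop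
    apply LinearMap.ext_on (s := b '' (Finset.Icc 1 n : Finset ℕ)) htop.symm
    rintro _ ⟨j, hj, rfl⟩
    exact hc j hj
  have hb : b i = 0 := hf.1 (by rw [h0, map_zero])
  exact nmem i hi (by rw [hb]; exact Submodule.zero_mem _)

theorem NF.step {n : ℕ} {f : (Fin n → ℂ) →ₗ[ℂ] Module.Dual ℂ (Fin n → ℂ)}
    {E b z T} (hE : IsCompleteFlag n E)
    (hf : Function.Bijective f) (hskew : ∀ v w : Fin n → ℂ, f v w = -(f w v))
    (h : NF n f E b z T) (hT : T ≠ Finset.Icc 1 n) :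
    ∃ b' z' T', NF n f E b' z' T' ∧ T.card < T'.card := by
  have hself : ∀ v, f v v = 0 := fun v => self_eq_neg.1 (hskew v v)
  have hne : ∃ i, i ∈ Finset.Icc 1 n ∧ i ∉ T := by
    by_contra! hc
    exact hT (Finset.Subset.antisymm h.sub hc)
  obtain ⟨p, ⟨hp, hpT⟩, hpmin⟩ : ∃ p, (p ∈ Finset.Icc 1 n ∧ p ∉ T) ∧
      ∀ i, i ∈ Finset.Icc 1 n → i ∉ T → p ≤ i :=
    ⟨Nat.find hne, Nat.find_spec hne, fun i h1 h2 => Nat.find_min' hne ⟨h1, h2⟩⟩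
  have hex := exists_ne hE hf h.mem h.nmem p hp
  obtain ⟨k, ⟨hk, hck⟩, hkmin⟩ : ∃ k, (k ∈ Finset.Icc 1 n ∧ f (b p) (b k) ≠ 0) ∧
      ∀ i, i ∈ Finset.Icc 1 n → i < k → f (b p) (b i) = 0 :=
    ⟨Nat.find hex, Nat.find_spec hex, fun i h1 h2 => by
      have := Nat.find_min hex h2
      push Not at this
      exact this h1⟩
  have hTz : ∀ i ∈ T, ∀ j ∈ Finset.Icc 1 n, j ∉ T → f (b i) (b j) = 0 := by
    intro i hi j hj hjT
    exact h.zero i hi j hj (fun e => hjT (e ▸ h.zT hi))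
  have hkT : k ∉ T := by
    intro hkT
    apply hck
    rw [hskew, hTz k hkT p hp hpT, neg_zero]
  have hkp : k ≠ p := by
    rintro rfl
    exact hck (hself _)
  have hpk : p < k := lt_of_le_of_ne (hpmin k hk hkT) hkp.symm
  obtain ⟨c, hc⟩ : ∃ c, c = f (b p) (b k) := ⟨_, rfl⟩
  have hc0 : c ≠ 0 := hc ▸ hck
  obtain ⟨u, hu⟩ : ∃ u, u = c⁻¹ • b k := ⟨_, rfl⟩
  obtain ⟨e, he⟩ : ∃ e, e = b p := ⟨_, rfl⟩
  have heu : f e u = 1 := by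
    rw [he, hu, map_smul, ← hc, smul_eq_mul, inv_mul_cancel₀ hc0]
  have hue : f u e = -1 := by rw [hskew, heu]
  have hTe : ∀ i ∈ T, f (b i) e = 0 := fun i hi => he ▸ hTz i hi p hp hpT
  have hTu : ∀ i ∈ T, f (b i) u = 0 := fun i hi => by
    rw [hu, map_smul, hTz i hi k hk hkT, smul_zero]
  let b' : ℕ → (Fin n → ℂ) := fun i => if i = p then e else if i = k then u else
    b i - f (b i) u • e + f (b i) e • u
  have b'p : b' p = e := by simp [b']
  have b'k : b' k = u := by simp [b', hkp]
  have b'o : ∀ i, i ≠ p → i ≠ k → b' i = b i - f (b i) u • e + f (b i) e • u := by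
    intro i h1 h2; simp [b', h1, h2]
  have b'T : ∀ i ∈ T, b' i = b i := by
    intro i hi
    rw [b'o i (fun e => hpT (e ▸ hi)) (fun e => hkT (e ▸ hi)), hTe i hi, hTu i hi]
    simp
  have b'low : ∀ i ∈ Finset.Icc 1 n, i ≠ p → i ≠ k → b' i - b i ∈ E (i - 1) := by
    intro i hi h1 h2
    by_cases hiT : i ∈ T
    · rw [b'T i hiT, sub_self]; exact Submodule.zero_mem _
    · have hpi : p < i := lt_of_le_of_ne (hpmin i hi hiT) h1.symm
      have heE : e ∈ E (i - 1) := he ▸ hE.1 p (i-1) (by omega) (h.mem p hp)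
      have h3 : f (b i) e • u ∈ E (i - 1) := by
        by_cases hik : i < k
        · rw [hskew, he, hkmin i hi hik, neg_zero, zero_smul]; exact Submodule.zero_mem _
        · apply Submodule.smul_mem
          rw [hu]
          exact Submodule.smul_mem _ _ (hE.1 k (i-1) (by omega) (h.mem k hk))
      rw [b'o i h1 h2]
      have : b i - f (b i) u • e + f (b i) e • u - b i = f (b i) e • u - f (b i) u • e := by
        abel
      rw [this]
      exact Submodule.sub_mem _ h3 (Submodule.smul_mem _ _ heE)
  have hb'e : ∀ j, j ≠ k → f e (b' j) = 0 := by
    intro j hj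
    by_cases hjp : j = p
    · rw [hjp, b'p, hself]
    · rw [b'o j hjp hj, map_add, map_sub, map_smul, map_smul, heu, hself, hskew (b j) e]
      simp
  have hb'u : ∀ j, j ≠ p → f u (b' j) = 0 := by
    intro j hj
    by_cases hjp : j = k
    · rw [hjp, b'k, hself]
    · rw [b'o j hj hjp, map_add, map_sub, map_smul, map_smul, hue, hself, hskew (b j) u]
      simp
  have hzp : z p = p := h.out p hpT
  have hzk : z k = k := h.out k hkT
  let z' : Equiv.Perm ℕ := z * Equiv.swap p k
  have z'p : z' p = k := by simp [z', hzk]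
  have z'k : z' k = p := by simp [z', hzp]
  have z'o : ∀ i, i ≠ p → i ≠ k → z' i = z i := by
    intro i h1 h2; simp [z', Equiv.swap_apply_of_ne_of_ne h1 h2]
  have z'T : ∀ i ∈ T, z' i = z i := by
    intro i hi
    exact z'o i (fun e => hpT (e ▸ hi)) (fun e => hkT (e ▸ hi))
  refine ⟨b', z', insert p (insert k T), ⟨?_, ?_, ?_, ?_, ?_, ?_, ?_, ?_⟩, ?_⟩
  · intro i hi
    simp only [Finset.mem_insert] at hi
    rcases hi with rfl | rfl | hi
    · exact hp
    · exact hk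
    · exact h.sub hi
  · intro i hi
    by_cases h1 : i = p
    · rw [h1, b'p, he]; exact h.mem p hp
    by_cases h2 : i = k
    · rw [h2, b'k, hu]; exact Submodule.smul_mem _ _ (h.mem k hk)
    have := Submodule.add_mem _ (hE.1 (i-1) i (by omega) (b'low i hi h1 h2)) (h.mem i hi)
    simpa using this
  · intro i hi
    by_cases h1 : i = p
    · rw [h1, b'p, he]; exact h.nmem p hp
    by_cases h2 : i = k
    · rw [h2, b'k, hu, Submodule.smul_mem_iff _ (inv_ne_zero hc0)]; exact h.nmem k hk
    intro h3
    have := Submodule.sub_mem _ h3 (b'low i hi h1 h2)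
    exact h.nmem i hi (by simpa using this)
  · intro i
    by_cases h1 : i = p
    · rw [h1, z'p, z'k]
    by_cases h2 : i = k
    · rw [h2, z'k, z'p]
    rw [z'o i h1 h2, z'o, h.inv]
    · intro h3; apply h1; rw [← h.inv i, h3, hzp]
    · intro h3; apply h2; rw [← h.inv i, h3, hzk]
  · intro i hi
    simp only [Finset.mem_insert, not_or] at hi
    rw [z'o i hi.1 hi.2.1, h.out i hi.2.2]
  · intro i hi
    simp only [Finset.mem_insert] at hi
    rcases hi with h1 | h1 | hi
    · rw [h1, z'p]; exact hkp
    · rw [h1, z'k]; exact hkp.symm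
    · rw [z'T i hi]; exact h.ne i hi
  · intro i hi j hj hjz
    simp only [Finset.mem_insert] at hi
    rcases hi with h1 | h1 | hi
    · rw [h1, z'p] at hjz
      rw [h1, b'p]; exact hb'e j hjz
    · rw [h1, z'k] at hjz
      rw [h1, b'k]; exact hb'u j hjz
    · rw [z'T i hi] at hjz
      rw [b'T i hi]
      by_cases h1 : j = p
      · rw [h1, b'p, hTe i hi]
      by_cases h2 : j = k
      · rw [h2, b'k, hTu i hi]
      rw [b'o j h1 h2, map_add, map_sub, map_smul, map_smul, hTe i hi, hTu i hi,
        h.zero i hi j hj hjz]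
      simp
  · intro i hi hlt
    simp only [Finset.mem_insert] at hi
    rcases hi with h1 | h1 | hi
    · rw [h1, z'p, b'p, b'k, heu]
    · rw [h1, z'k] at hlt
      omega
    · rw [z'T i hi] at hlt ⊢
      rw [b'T i hi, b'T _ (h.zT hi), h.one i hi hlt]
  · rw [Finset.card_insert_of_notMem, Finset.card_insert_of_notMem hkT]
    · omega
    · simp [hpT, hkp.symm]

theorem NF.finish {n : ℕ} {f : (Fin n → ℂ) →ₗ[ℂ] Module.Dual ℂ (Fin n → ℂ)}
    {E} (hE : IsCompleteFlag n E)
    (hf : Function.Bijective f) (hskew : ∀ v w : Fin n → ℂ, f v w = -(f w v)) (d : ℕ) :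
    ∀ b z T, NF n f E b z T → n - T.card ≤ d → ∃ b z, NF n f E b z (Finset.Icc 1 n) := by
  induction d with
  | zero =>
    intro b z T h hd
    have : T = Finset.Icc 1 n := Finset.eq_of_subset_of_card_le h.sub (by simp; omega)
    exact ⟨b, z, this ▸ h⟩
  | succ d ih =>
    intro b z T h hd
    by_cases hT : T = Finset.Icc 1 n
    · exact ⟨b, z, hT ▸ h⟩
    · obtain ⟨b', z', T', h', hlt⟩ := h.step hE hf hskew hT
      exact ih b' z' T' h' (by omega)

theorem exists_NF {n : ℕ} {f : (Fin n → ℂ) →ₗ[ℂ] Module.Dual ℂ (Fin n → ℂ)}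
    {E} (hE : IsCompleteFlag n E)
    (hf : Function.Bijective f) (hskew : ∀ v w : Fin n → ℂ, f v w = -(f w v)) :
    ∃ b z, NF n f E b z (Finset.Icc 1 n) := by
  have : ∀ i, ∃ v, i ∈ Finset.Icc 1 n → v ∈ E i ∧ v ∉ E (i - 1) := by
    intro i
    by_cases hi : i ∈ Finset.Icc 1 n
    · have hi' := Finset.mem_Icc.1 hi
      have : ¬ E i ≤ E (i-1) := by
        intro hle
        have := Submodule.finrank_mono hle
        rw [hE.2.1 i hi'.2, hE.2.1 (i-1) (by omega)] at this
        omega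
      obtain ⟨v, h1, h2⟩ := SetLike.not_le_iff_exists.1 this
      exact ⟨v, fun _ => ⟨h1, h2⟩⟩
    · exact ⟨0, fun h => absurd h hi⟩
  choose b hb using this
  refine NF.finish hE hf hskew n b 1 ∅ ⟨by simp, fun i hi => (hb i hi).1,
    fun i hi => (hb i hi).2, fun i => rfl, fun i _ => rfl, by simp, by simp, by simp⟩ (by simp)

theorem NF.nz {n : ℕ} {f : (Fin n → ℂ) →ₗ[ℂ] Module.Dual ℂ (Fin n → ℂ)}
    {E b z} (hskew : ∀ v w : Fin n → ℂ, f v w = -(f w v))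
    (h : NF n f E b z (Finset.Icc 1 n)) (i : ℕ) (hi : i ∈ Finset.Icc 1 n) :
    f (b i) (b (z i)) = if i < z i then 1 else -1 := by
  split_ifs with hlt
  · exact h.one i hi hlt
  · have h1 := h.ne i hi
    have h2 := h.one (z i) (h.zT hi) (by rw [h.inv]; omega)
    rw [h.inv] at h2
    rw [hskew, h2]

theorem NF.nz' {n : ℕ} {f : (Fin n → ℂ) →ₗ[ℂ] Module.Dual ℂ (Fin n → ℂ)}
    {E b z} (hskew : ∀ v w : Fin n → ℂ, f v w = -(f w v))
    (h : NF n f E b z (Finset.Icc 1 n)) (i : ℕ) (hi : i ∈ Finset.Icc 1 n) :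
    f (b i) (b (z i)) ≠ 0 := by
  rw [h.nz hskew i hi]; split_ifs <;> simp

theorem NF.rank {n : ℕ} {f : (Fin n → ℂ) →ₗ[ℂ] Module.Dual ℂ (Fin n → ℂ)}
    {E b z} (hE : IsCompleteFlag n E)
    (hskew : ∀ v w : Fin n → ℂ, f v w = -(f w v))
    (h : NF n f E b z (Finset.Icc 1 n)) (i j : ℕ) (hi : i ≤ n) (hj : j ≤ n) :
    rkFE f (E j) (E i) = rankUL z i j := by
  let L : (Fin n → ℂ) →ₗ[ℂ] Module.Dual ℂ (E i) := (E i).subtype.dualMap ∘ₗ f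
  have hL : ∀ v (w : E i), L v w = f v w := fun v w => rfl
  let S := (Finset.Icc 1 j).filter fun a => z a ∈ Finset.Icc 1 i
  have hspan := flag_span_s19 hE h.mem h.nmem i hi
  have hr : LinearMap.range ((E i).subtype.dualMap ∘ₗ (f ∘ₗ (E j).subtype)) =
      Submodule.span ℂ (Set.range fun a : S => L (b a)) := by
    rw [← LinearMap.comp_assoc, LinearMap.range_comp, Submodule.range_subtype,
      flag_span_s19 hE h.mem h.nmem j hj, Submodule.map_span]
    apply le_antisymm
    · rw [Submodule.span_le]
      rintro _ ⟨_, ⟨a, ha, rfl⟩, rfl⟩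
      by_cases haS : a ∈ S
      · exact Submodule.subset_span ⟨⟨a, haS⟩, rfl⟩
      · have ha' : a ∈ Finset.Icc 1 j := ha
        have haz : z a ∉ Finset.Icc 1 i := fun hz => haS (Finset.mem_filter.2 ⟨ha', hz⟩)
        have han : a ∈ Finset.Icc 1 n := by
          simp only [Finset.mem_Icc] at ha' ⊢; omega
        have : L (b a) = 0 := by
          have key : E i ≤ LinearMap.ker (f (b a)) := by
            rw [hspan, Submodule.span_le]
            rintro _ ⟨c, hc, rfl⟩
            have hc' : c ∈ Finset.Icc 1 i := hc
            refine h.zero a han c ?_ (fun e => haz (e ▸ hc'))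
            simp only [Finset.mem_Icc] at hc' ⊢; omega
          ext w
          exact key w.2
        change L (b a) ∈ _
        rw [this]; exact Submodule.zero_mem _
    · apply Submodule.span_mono
      rintro _ ⟨a, rfl⟩
      exact ⟨b a, ⟨a, (Finset.mem_filter.1 a.2).1, rfl⟩, rfl⟩
  have hli : LinearIndependent ℂ (fun a : S => L (b a)) := by
    rw [Fintype.linearIndependent_iff]
    intro g hg a
    have ha := Finset.mem_filter.1 a.2
    have han : ∀ a : S, (a : ℕ) ∈ Finset.Icc 1 n := fun a => by
      have := (Finset.mem_filter.1 a.2).1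
      simp only [Finset.mem_Icc] at this ⊢; omega
    have hm : b (z a) ∈ E i := hE.1 _ _ (Finset.mem_Icc.1 ha.2).2 (h.mem _ (h.zT (han a)))
    have := congrArg (fun φ => φ ⟨b (z a), hm⟩) hg
    simp only [LinearMap.sum_apply, LinearMap.smul_apply, hL, LinearMap.zero_apply] at this
    rw [Finset.sum_eq_single a] at this
    · rcases smul_eq_zero.1 this with h1 | h1
      · exact h1
      · exact absurd h1 (h.nz' hskew a (han a))
    · intro c _ hca
      rw [h.zero c (han c) _ (h.zT (han a)), smul_zero]
      intro e
      exact hca (Subtype.ext (z.injective e).symm)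
    · simp
  unfold rkFE rankUL
  rw [hr, finrank_span_eq_card hli, Fintype.card_coe]
  refine Finset.card_bij (fun a _ => z a) ?_ ?_ ?_
  · intro a ha
    have ha := Finset.mem_filter.1 ha
    refine Finset.mem_filter.2 ⟨ha.2, ?_⟩
    rw [h.inv]; exact ha.1
  · intro a _ c _ e; exact z.injective e
  · intro a ha
    have ha := Finset.mem_filter.1 ha
    exact ⟨z a, Finset.mem_filter.2 ⟨ha.2, by rw [h.inv]; exact ha.1⟩, h.inv a⟩

theorem permOn_mem {n : ℕ} {z : Equiv.Perm ℕ} (h : IsPermOn n z) {i : ℕ}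
    (hi : i ∈ Finset.Icc 1 n) : z i ∈ Finset.Icc 1 n := by
  by_contra hc
  have := z.injective (h _ hc)
  rw [this] at hc
  exact hc hi

theorem rankUL_succ (z : Equiv.Perm ℕ) (i j : ℕ) :
    rankUL z (i+1) j = rankUL z i j + if z (i+1) ∈ Finset.Icc 1 j then 1 else 0 := by
  unfold rankUL
  rw [← Finset.insert_Icc_right_eq_Icc_add_one (by omega), Finset.filter_insert]
  split_ifs with h1
  · rw [Finset.card_insert_of_notMem (by simp)]
  · rfl

theorem z_unique {n : ℕ} {z z' : Equiv.Perm ℕ} (h : IsPermOn n z) (h' : IsPermOn n z')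
    (hr : ∀ i j, 1 ≤ i → i ≤ n → 1 ≤ j → j ≤ n → rankUL z i j = rankUL z' i j) : z = z' := by
  have key : ∀ i ∈ Finset.Icc 1 n, ∀ j ∈ Finset.Icc 1 n, (z i ≤ j ↔ z' i ≤ j) := by
    intro i hi j hj
    have hz := Finset.mem_Icc.1 (permOn_mem h hi)
    have hz' := Finset.mem_Icc.1 (permOn_mem h' hi)
    rw [Finset.mem_Icc] at hi hj
    obtain ⟨m, rfl⟩ : ∃ m, i = m + 1 := ⟨i - 1, by omega⟩
    have h1 := hr (m+1) j hi.1 hi.2 hj.1 hj.2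
    have h0 : rankUL z m j = rankUL z' m j := by
      rcases Nat.eq_zero_or_pos m with rfl | hm
      · simp [rankUL]
      · exact hr m j hm (by omega) hj.1 hj.2
    rw [rankUL_succ, rankUL_succ, h0] at h1
    simp only [Finset.mem_Icc] at h1
    split_ifs at h1 <;> omega
  ext i
  by_cases hi : i ∈ Finset.Icc 1 n
  · apply le_antisymm
    · exact (key i hi _ (permOn_mem h' hi)).2 le_rfl
    · exact (key i hi _ (permOn_mem h hi)).1 le_rfl
  · rw [h i hi, h' i hi]

theorem NF.basis {n : ℕ} {f : (Fin n → ℂ) →ₗ[ℂ] Module.Dual ℂ (Fin n → ℂ)}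
    {E b z} (hE : IsCompleteFlag n E)
    (h : NF n f E b z (Finset.Icc 1 n)) :
    ∃ B : Module.Basis (Finset.Icc 1 n) ℂ (Fin n → ℂ), ∀ i, B i = b i := by
  have htop := flag_span_s19 hE h.mem h.nmem n le_rfl
  rw [hE.2.2] at htop
  have hr : (Set.range fun a : Finset.Icc 1 n => b a) = b '' (Finset.Icc 1 n : Finset ℕ) := by
    ext x; simp
  have hs : ⊤ ≤ Submodule.span ℂ (Set.range fun a : Finset.Icc 1 n => b a) := by
    rw [hr, ← htop]
  exact ⟨basisOfTopLeSpanOfCardEqFinrank _ hs (by simp), fun i => by simp⟩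

theorem orbit_description_OG (n : ℕ)
    (f f' : (Fin n → ℂ) →ₗ[ℂ] Module.Dual ℂ (Fin n → ℂ))
    (hf : Function.Bijective f) (hf' : Function.Bijective f')
    (hskew : ∀ v w : Fin n → ℂ, f v w = -(f w v))
    (hskew' : ∀ v w : Fin n → ℂ, f' v w = -(f' w v))
    (E E' : ℕ → Submodule ℂ (Fin n → ℂ))
    (hE : IsCompleteFlag n E) (hE' : IsCompleteFlag n E') :
    (∃! z : Equiv.Perm ℕ, IsPermOn n z ∧ Function.Involutive ⇑z ∧
      (∀ i, 1 ≤ i → i ≤ n → z i ≠ i) ∧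
      ∀ i j, 1 ≤ i → i ≤ n → 1 ≤ j → j ≤ n →
        rkFE f (E j) (E i) = rankUL z i j) ∧
    ((∀ i j, 1 ≤ i → i ≤ n → 1 ≤ j → j ≤ n →
        rkFE f (E j) (E i) = rkFE f' (E' j) (E' i)) ↔
      ∃ g : (Fin n → ℂ) ≃ₗ[ℂ] (Fin n → ℂ),
        (∀ v, f' v = g.dualMap.symm (f (g.symm v))) ∧
        (∀ i, 1 ≤ i → i ≤ n →
          E' i = (E i).map (g : (Fin n → ℂ) →ₗ[ℂ] (Fin n → ℂ)))) := by
  obtain ⟨b, z, h⟩ := exists_NF hE hf hskew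
  obtain ⟨b', z', h'⟩ := exists_NF hE' hf' hskew'
  have hrk := fun i j (_ : 1 ≤ i) (hi : i ≤ n) (_ : 1 ≤ j) (hj : j ≤ n) =>
    h.rank hE hskew i j hi hj
  have hrk' := fun i j (_ : 1 ≤ i) (hi : i ≤ n) (_ : 1 ≤ j) (hj : j ≤ n) =>
    h'.rank hE' hskew' i j hi hj
  refine ⟨⟨z, ⟨h.out, h.inv, fun i h1 h2 => h.ne i (Finset.mem_Icc.2 ⟨h1, h2⟩), hrk⟩, ?_⟩, ?_, ?_⟩
  · rintro y ⟨hy, -, -, hyr⟩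
    refine z_unique hy h.out fun i j h1 h2 h3 h4 => ?_
    rw [← hyr i j h1 h2 h3 h4, hrk i j h1 h2 h3 h4]
  · intro hr
    have hz : z = z' := z_unique h.out h'.out fun i j h1 h2 h3 h4 => by
      rw [← hrk i j h1 h2 h3 h4, hr i j h1 h2 h3 h4, hrk' i j h1 h2 h3 h4]
    subst hz
    obtain ⟨B, hB⟩ := h.basis hE
    obtain ⟨B', hB'⟩ := h'.basis hE'
    let g := B.equiv B' (Equiv.refl _)
    have hg : ∀ i ∈ Finset.Icc 1 n, g (b i) = b' i := by
      intro i hi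
      have := B.equiv_apply ⟨i, hi⟩ B' (Equiv.refl _)
      rw [hB, Equiv.refl_apply, hB'] at this
      exact this
    refine ⟨g, ?_, ?_⟩
    · have hgs : ∀ i ∈ Finset.Icc 1 n, g.symm (b' i) = b i := by
        intro i hi
        rw [← hg i hi, LinearEquiv.symm_apply_apply]
      have : f' = g.dualMap.symm.toLinearMap ∘ₗ f ∘ₗ g.symm.toLinearMap := by
        refine B'.ext fun i => B'.ext fun j => ?_
        rw [hB', hB']
        change f' (b' i) (b' j) = f (g.symm (b' i)) (g.symm (b' j))
        rw [hgs i i.2, hgs j j.2]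
        by_cases hj : (j : ℕ) = z i
        · rw [hj, h.nz hskew i i.2, h'.nz hskew' i i.2]
        · rw [h.zero i i.2 j j.2 hj, h'.zero i i.2 j j.2 hj]
      intro v
      exact congrArg (fun φ => φ v) this
    · intro i h1 h2
      rw [flag_span_s19 hE h.mem h.nmem i h2, flag_span_s19 hE' h'.mem h'.nmem i h2, Submodule.map_span,
        ← Set.image_comp]
      congr 1
      apply Set.image_congr
      intro a ha
      simp only [Finset.coe_Icc, Set.mem_Icc] at ha
      exact (hg a (Finset.mem_Icc.2 ⟨ha.1, by omega⟩)).symm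
  · rintro ⟨g, hgf, hgE⟩ i j h1 h2 h3 h4
    have hgg : ∀ v w, f' (g v) (g w) = f v w := by
      intro v w
      rw [hgf, LinearEquiv.symm_apply_apply]
      change f v (g.symm (g w)) = _
      rw [LinearEquiv.symm_apply_apply]
    have hgE0 : ∀ i, i ≤ n → E' i = (E i).map (g : (Fin n → ℂ) →ₗ[ℂ] (Fin n → ℂ)) := by
      intro i hi
      rcases Nat.eq_zero_or_pos i with rfl | h0
      · rw [flag_zero hE, flag_zero hE', Submodule.map_bot]
      · exact hgE i h0 hi
    have hN : NF n f' E' (fun i => g (b i)) z (Finset.Icc 1 n) := by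
      refine ⟨h.sub, ?_, ?_, h.inv, h.out, h.ne, ?_, ?_⟩
      · intro i hi
        rw [hgE0 i (Finset.mem_Icc.1 hi).2]
        exact Submodule.mem_map_of_mem (h.mem i hi)
      · intro i hi hm
        rw [hgE0 (i-1) (by have := (Finset.mem_Icc.1 hi).2; omega)] at hm
        obtain ⟨x, hx, hxe⟩ := hm
        have : x = b i := g.injective hxe
        exact h.nmem i hi (this ▸ hx)
      · intro i hi j hj hne
        rw [hgg]; exact h.zero i hi j hj hne
      · intro i hi hlt
        rw [hgg]; exact h.one i hi hlt
    rw [h.rank hE hskew i j h2 h4, hN.rank hE' hskew' i j h2 h4]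
end UGS
end
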